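/- For every T > 0 and every H ∈ (0,1), the squared L²-norm of the fractional Brownian motion kernel equals the sum of squares of its expansion coefficients relative to the Legendre polynomials: the double series Σ_{i=0}^∞ Σ_{j=0}^∞ (K_{ij}^H)² converges and its sum equals T^{2H+1}/(2H+1). -/

import Mathlib

open MeasureTheory Finset

/-- Coefficients of the shifted Legendre polynomials:
`l_{ik} = (-1)^(i-k) * C(i+k, i) * C(i, i-k)`. -/
noncomputable def legCoef (i k : ℕ) : ℝ :=
  (-1 : ℝ) ^ (i - k) * (Nat.choose (i + k) i : ℝ) * (Nat.choose i (i - k) : ℝ)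

/-- Shifted Legendre polynomials on `[0, T]`, orthonormal in `L²([0,T])`:
`P̂(i,t) = √((2i+1)/T) · Σ_{k=0}^i l_{ik} (t/T)^k`. -/
noncomputable def legP (T : ℝ) (i : ℕ) (t : ℝ) : ℝ :=
  Real.sqrt ((2 * i + 1) / T) * ∑ k ∈ Finset.range (i + 1), legCoef i k * (t / T) ^ k

/-- `F_i^α = ∫₀^T t^α P̂(i,t) dt`, the expansion coefficient of the power function
`t ↦ t^α` relative to the `i`-th Legendre polynomial. -/
noncomputable def Fcoef (T α : ℝ) (i : ℕ) : ℝ :=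
  ∫ t in (0:ℝ)..T, t ^ α * legP T i t

/-- Rising factorial `x^{\overline{k}} = x(x+1)⋯(x+k-1)`. -/
noncomputable def riseFac (x : ℝ) (k : ℕ) : ℝ :=
  ∏ m ∈ Finset.range k, (x + m)

/-- Left-sided Riemann–Liouville fractional integral of order `β`:
`(J^β φ)(t) = (1/Γ(β)) ∫₀^t φ(τ)(t-τ)^{β-1} dτ`. -/
noncomputable def rlInt (β : ℝ) (φ : ℝ → ℝ) (t : ℝ) : ℝ :=
  (1 / Real.Gamma β) * ∫ τ in (0:ℝ)..t, φ τ * (t - τ) ^ (β - 1)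

/-- `a_H = √(2H·Γ(H+1/2)·Γ(3/2-H)/Γ(2-2H))`. -/
noncomputable def aH (H : ℝ) : ℝ :=
  Real.sqrt (2 * H * Real.Gamma (H + 1/2) * Real.Gamma (3/2 - H) / Real.Gamma (2 - 2 * H))

open scoped Classical in
/-- The operator `𝒦_H` corresponding to the kernel of the integral representation of the
fractional Brownian motion with Hurst index `H`. -/
noncomputable def Kop (H : ℝ) (φ : ℝ → ℝ) (t : ℝ) : ℝ :=
  if H < 1/2 then
    aH H * rlInt (2 * H)
      (fun s => s ^ ((1:ℝ)/2 - H) * rlInt ((1:ℝ)/2 - H) (fun τ => τ ^ (H - 1/2) * φ τ) s) t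
  else if 1/2 < H then
    aH H * rlInt 1
      (fun s => s ^ (H - (1:ℝ)/2) * rlInt (H - (1:ℝ)/2) (fun τ => τ ^ ((1:ℝ)/2 - H) * φ τ) s) t
  else ∫ τ in (0:ℝ)..t, φ τ

/-- `K_{ij}^H = ∫₀^T P̂(i,t) (𝒦_H P̂(j,·))(t) dt`, the expansion coefficients of the
fractional Brownian motion kernel relative to the Legendre polynomials on `[0,T]`. -/
noncomputable def Kcoef (T H : ℝ) (i j : ℕ) : ℝ :=
  ∫ t in (0:ℝ)..T, legP T i t * Kop H (legP T j) t

open Polynomial in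
/-- Repeated integration by parts against the derivatives of a polynomial that vanishes to order
`n` at both endpoints of `[0, 1]`. -/
theorem integral_mul_iterate_derivative (n : ℕ) (p : ℝ[X]) (m : ℕ) (hm : m ≤ n) :
    ∫ x in (0:ℝ)..1, p.eval x * (derivative^[m] (X ^ n * (1 - X) ^ n)).eval x =
      (-1) ^ m * ∫ x in (0:ℝ)..1,
        (derivative^[m] p).eval x * ((X ^ n * (1 - X) ^ n : ℝ[X]).eval x) := by
  induction m generalizing p with
  | zero => simp
  | succ m ih =>
    set Q : ℝ[X] := X ^ n * (1 - X) ^ n with hQ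
    have h0 : (derivative^[m] Q).eval 0 = 0 := by
      obtain ⟨r, hr⟩ := pow_sub_dvd_iterate_derivative_of_pow_dvd (q := (X : ℝ[X])) (p := Q)
        (n := n) m (Dvd.intro _ rfl)
      rw [hr]
      simp [Nat.sub_ne_zero_of_lt (show m < n by omega)]
    have h1 : (derivative^[m] Q).eval 1 = 0 := by
      obtain ⟨r, hr⟩ := pow_sub_dvd_iterate_derivative_of_pow_dvd (q := (1 - X : ℝ[X])) (p := Q)
        (n := n) m (Dvd.intro_left _ rfl)
      rw [hr]
      simp [Nat.sub_ne_zero_of_lt (show m < n by omega)]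
    have key := intervalIntegral.integral_mul_deriv_eq_deriv_mul (a := (0:ℝ)) (b := 1)
      (u := fun x => p.eval x) (v := fun x => (derivative^[m] Q).eval x)
      (u' := fun x => (derivative p).eval x)
      (v' := fun x => (derivative (derivative^[m] Q)).eval x)
      (fun x _ => p.hasDerivAt x) (fun x _ => (derivative^[m] Q).hasDerivAt x)
      ((derivative p).continuous.intervalIntegrable _ _)
      ((derivative (derivative^[m] Q)).continuous.intervalIntegrable _ _)
    rw [Function.iterate_succ_apply', key, h0, h1, ih _ (by omega)]
    rw [← Function.iterate_succ_apply]
    ring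

/-- Euler's beta integral, as a lower Lebesgue integral. -/
theorem lintegral_rpow_mul_one_sub_rpow {a b : ℝ} (ha : 0 < a) (hb : 0 < b) :
    ∫⁻ x in Set.Ioo (0:ℝ) 1, ENNReal.ofReal (x ^ (a - 1) * (1 - x) ^ (b - 1)) =
      ENNReal.ofReal (ProbabilityTheory.beta a b) := by
  have h := ProbabilityTheory.lintegral_betaPDF_eq_one ha hb
  rw [ProbabilityTheory.lintegral_betaPDF] at h
  have hpos := ProbabilityTheory.beta_pos ha hb
  simp_rw [mul_assoc, ENNReal.ofReal_mul (one_div_pos.2 hpos).le] at h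
  rw [lintegral_const_mul _ (by fun_prop), one_div, ENNReal.ofReal_inv_of_pos hpos] at h
  rw [← one_mul (∫⁻ x in _, _),
    ← ENNReal.mul_inv_cancel (a := ENNReal.ofReal (ProbabilityTheory.beta a b)) (by simpa)
      ENNReal.ofReal_ne_top, mul_assoc, h, mul_one]

theorem integral_pow_mul_one_sub_pow (n : ℕ) :
    ∫ x in (0:ℝ)..1, x ^ n * (1 - x) ^ n = (n.factorial : ℝ) ^ 2 / (2 * n + 1).factorial := by
  have h := lintegral_rpow_mul_one_sub_rpow (a := n + 1) (b := n + 1) (by positivity)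
    (by positivity)
  simp only [add_sub_cancel_right, Real.rpow_natCast] at h
  rw [intervalIntegral.integral_of_le zero_le_one, integral_Ioc_eq_integral_Ioo,
    integral_eq_lintegral_of_nonneg_ae, h, ENNReal.toReal_ofReal, ProbabilityTheory.beta,
    Real.Gamma_nat_eq_factorial, sq]
  · congr 1
    rw [← Real.Gamma_nat_eq_factorial]
    congr 1
    push_cast
    ring
  · exact (ProbabilityTheory.beta_pos (by positivity) (by positivity)).le
  · refine ae_restrict_of_forall_mem measurableSet_Ioo fun x hx => ?_
    have := hx.1.le
    have := sub_nonneg.2 hx.2.le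
    simp only [Pi.zero_apply]
    positivity
  · fun_prop

/-- The shifted Legendre polynomials with real coefficients. -/
noncomputable def realShiftedLegendre (i : ℕ) : Polynomial ℝ :=
  (Polynomial.shiftedLegendre i).map (Int.castRingHom ℝ)

open Polynomial in
theorem factorial_mul_realShiftedLegendre (i : ℕ) :
    C (i.factorial : ℝ) * realShiftedLegendre i = derivative^[i] (X ^ i * (1 - X) ^ i) := by
  have h := congrArg (Polynomial.map (Int.castRingHom ℝ)) (factorial_mul_shiftedLegendre_eq i)
  rw [← iterate_derivative_map] at h
  simpa [realShiftedLegendre] using h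

theorem natDegree_realShiftedLegendre (i : ℕ) : (realShiftedLegendre i).natDegree = i := by
  rw [realShiftedLegendre, Polynomial.natDegree_map_eq_of_injective
    (RingHom.injective_int (Int.castRingHom ℝ)), Polynomial.natDegree_shiftedLegendre]

theorem coeff_realShiftedLegendre (i k : ℕ) : (realShiftedLegendre i).coeff k =
    (-1) ^ k * (i.choose k) * ((i + k).choose i) := by
  simp [realShiftedLegendre, Polynomial.coeff_shiftedLegendre]

open Polynomial in
theorem integral_mul_realShiftedLegendre (i : ℕ) (p : ℝ[X]) :
    (i.factorial : ℝ) * ∫ x in (0:ℝ)..1, p.eval x * (realShiftedLegendre i).eval x =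
      (-1) ^ i * ∫ x in (0:ℝ)..1, (derivative^[i] p).eval x * (x ^ i * (1 - x) ^ i) := by
  have h := integral_mul_iterate_derivative i p i le_rfl
  rw [← factorial_mul_realShiftedLegendre] at h
  simp only [eval_mul, eval_C, eval_pow, eval_X, eval_sub, eval_one] at h
  rw [← h, ← intervalIntegral.integral_const_mul]
  congr 1 with x
  ring

theorem integral_realShiftedLegendre_of_lt {i j : ℕ} (h : j < i) :
    ∫ x in (0:ℝ)..1, (realShiftedLegendre j).eval x * (realShiftedLegendre i).eval x = 0 := by
  have := integral_mul_realShiftedLegendre i (realShiftedLegendre j)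
  rw [Polynomial.iterate_derivative_eq_zero (by rwa [natDegree_realShiftedLegendre])] at this
  simpa [Nat.factorial_ne_zero] using this

open Polynomial in
theorem integral_realShiftedLegendre_self (i : ℕ) :
    ∫ x in (0:ℝ)..1, (realShiftedLegendre i).eval x * (realShiftedLegendre i).eval x =
      1 / (2 * i + 1) := by
  have h := integral_mul_realShiftedLegendre i (realShiftedLegendre i)
  have hd : derivative^[i] (realShiftedLegendre i) =
      C ((i.factorial : ℝ) * ((-1) ^ i * ((i + i).choose i))) := by
    have h0 : (derivative^[i] (realShiftedLegendre i)).natDegree ≤ 0 := by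
      refine (natDegree_iterate_derivative _ _).trans ?_
      simp [natDegree_realShiftedLegendre]
    rw [eq_C_of_natDegree_le_zero h0, coeff_iterate_derivative, zero_add,
      coeff_realShiftedLegendre, Nat.descFactorial_self]
    simp
  rw [hd] at h
  simp only [eval_C, intervalIntegral.integral_const_mul, integral_pow_mul_one_sub_pow] at h
  have hf : (i.factorial : ℝ) ≠ 0 := by positivity
  have hc : ((i + i).choose i : ℝ) * i.factorial * i.factorial = (i + i).factorial := by
    exact_mod_cast Nat.add_choose_mul_factorial_mul_factorial i i
  have hg : ((2 * i + 1).factorial : ℝ) = (2 * i + 1) * (i + i).factorial := by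
    rw [Nat.factorial_succ, two_mul]
    push_cast
    ring
  have h2 : ((i + i).factorial : ℝ) ≠ 0 := by positivity
  have h3 : (2 * i + 1 : ℝ) ≠ 0 := by positivity
  have hs : ((-1 : ℝ) ^ i) * (-1) ^ i = 1 := by rw [← mul_pow]; simp
  apply mul_left_cancel₀ hf
  rw [h, hg]
  field_simp
  linear_combination (i.factorial : ℝ) ^ 2 * ((i + i).choose i) * hs + hc

theorem integral_realShiftedLegendre (i j : ℕ) :
    ∫ x in (0:ℝ)..1, (realShiftedLegendre i).eval x * (realShiftedLegendre j).eval x =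
      if i = j then 1 / (2 * i + 1 : ℝ) else 0 := by
  split_ifs with h
  · rw [← h, integral_realShiftedLegendre_self]
  · rcases lt_or_gt_of_ne h with h | h
    · exact integral_realShiftedLegendre_of_lt h
    · simpa only [mul_comm] using integral_realShiftedLegendre_of_lt h

theorem legP_eq (T : ℝ) (i : ℕ) (t : ℝ) : legP T i t =
    Real.sqrt ((2 * i + 1) / T) * ((-1) ^ i * (realShiftedLegendre i).eval (t / T)) := by
  rw [legP, Polynomial.eval_eq_sum_range, natDegree_realShiftedLegendre,
    Finset.mul_sum _ _ ((-1 : ℝ) ^ i)]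
  congr 1
  refine Finset.sum_congr rfl fun k hk => ?_
  have hk' : k ≤ i := by simpa [Nat.lt_succ_iff] using hk
  rw [legCoef, coeff_realShiftedLegendre, Nat.choose_symm hk']
  have hs : (-1 : ℝ) ^ (i - k) = (-1) ^ i * (-1) ^ k := by
    have hk2 : ((-1 : ℝ) ^ k) * (-1) ^ k = 1 := by rw [← mul_pow]; simp
    rw [← pow_sub_mul_pow (-1 : ℝ) hk', mul_assoc, hk2, mul_one]
  rw [hs]
  ring

theorem integral_legP_mul_legP {T : ℝ} (hT : 0 < T) (i j : ℕ) :
    ∫ t in (0:ℝ)..T, legP T i t * legP T j t = if i = j then 1 else 0 := by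
  have h : ∀ t, legP T i t * legP T j t =
      (Real.sqrt ((2 * i + 1) / T) * (-1) ^ i * (Real.sqrt ((2 * j + 1) / T) * (-1) ^ j)) *
      (fun x => (realShiftedLegendre i).eval x * (realShiftedLegendre j).eval x) (t / T) := by
    intro t
    rw [legP_eq, legP_eq]
    ring
  rw [intervalIntegral.integral_congr fun t _ => h t, intervalIntegral.integral_const_mul,
    intervalIntegral.integral_comp_div (fun x => (realShiftedLegendre i).eval x *
      (realShiftedLegendre j).eval x) hT.ne', zero_div,
    div_self hT.ne', integral_realShiftedLegendre]
  split_ifs with hij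
  · subst hij
    have hs : ((-1 : ℝ) ^ i) * (-1) ^ i = 1 := by rw [← mul_pow]; simp
    have hq := Real.mul_self_sqrt (show 0 ≤ (2 * i + 1 : ℝ) / T by positivity)
    generalize Real.sqrt ((2 * i + 1 : ℝ) / T) = q at *
    have h3 : (2 * i + 1 : ℝ) ≠ 0 := by positivity
    have : q * q * T = 2 * i + 1 := by rw [hq]; field_simp
    simp only [smul_eq_mul]
    field_simp
    linear_combination this + q ^ 2 * T * hs
  · simp

theorem continuous_legP (T : ℝ) (i : ℕ) : Continuous (legP T i) := by
  unfold legP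
  fun_prop

theorem Continuous.memLp_restrict_Ioc {f : ℝ → ℝ} (hf : Continuous f) (T : ℝ) :
    MemLp f 2 (volume.restrict (Set.Ioc 0 T)) := by
  obtain ⟨C, hC⟩ := (isCompact_Icc (a := (0:ℝ)) (b := T)).exists_bound_of_continuousOn
    hf.continuousOn
  exact MemLp.of_bound hf.aestronglyMeasurable C
    (ae_restrict_of_forall_mem measurableSet_Ioc fun x hx => hC x (Set.Ioc_subset_Icc_self hx))

theorem memLp_legP (T : ℝ) (i : ℕ) : MemLp (legP T i) 2 (volume.restrict (Set.Ioc 0 T)) :=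
  (continuous_legP T i).memLp_restrict_Ioc T

/-- The normalized shifted Legendre polynomials as elements of `L²(0, T]`. -/
noncomputable def legLp (T : ℝ) (i : ℕ) : Lp ℝ 2 (volume.restrict (Set.Ioc 0 T)) :=
  (memLp_legP T i).toLp

theorem inner_legLp {T : ℝ} (hT : 0 < T) (i : ℕ) {f : ℝ → ℝ}
    (hf : MemLp f 2 (volume.restrict (Set.Ioc 0 T))) :
    inner ℝ (legLp T i) hf.toLp = ∫ t in (0:ℝ)..T, legP T i t * f t := by
  rw [L2.inner_def, intervalIntegral.integral_of_le hT.le]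
  refine integral_congr_ae ?_
  filter_upwards [(memLp_legP T i).coeFn_toLp, hf.coeFn_toLp] with t h1 h2
  rw [legLp, h1, h2]
  simp [mul_comm]

theorem orthonormal_legLp {T : ℝ} (hT : 0 < T) : Orthonormal ℝ (legLp T) := by
  rw [orthonormal_iff_ite]
  intro i j
  rw [legLp, legLp, ← legLp, inner_legLp hT, integral_legP_mul_legP hT]

open Polynomial in
theorem continuous_eval_div (p : ℝ[X]) (T : ℝ) : Continuous fun t => p.eval (t / T) := by
  fun_prop

open Polynomial in
theorem toLp_polynomial_mem_span {T : ℝ} (hT : 0 < T) (p : ℝ[X]) :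
    ((continuous_eval_div p T).memLp_restrict_Ioc T).toLp ∈
      Submodule.span ℝ (Set.range (legLp T)) := by
  let S : Polynomial.Sequence ℝ := ⟨realShiftedLegendre, fun i => by
    have h0 : realShiftedLegendre i ≠ 0 := fun h => by
      have := integral_realShiftedLegendre_self i
      rw [h] at this
      have h3 : (2 * i + 1 : ℝ) ≠ 0 := by positivity
      simp at this
      exact h3 this.symm
    rw [degree_eq_natDegree h0, natDegree_realShiftedLegendre]⟩
  have hp : p ∈ Submodule.span ℝ (Set.range S) := by
    rw [S.span fun i => (leadingCoeff_ne_zero.2 (S.ne_zero i)).isUnit]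
    trivial
  induction hp using Submodule.span_induction with
  | mem q hq =>
    obtain ⟨i, rfl⟩ := hq
    have hc : Real.sqrt ((2 * i + 1) / T) ≠ 0 := (Real.sqrt_pos.2 (by positivity)).ne'
    have hS : ((continuous_eval_div (S i) T).memLp_restrict_Ioc T).toLp =
        ((-1) ^ i * (Real.sqrt ((2 * i + 1) / T))⁻¹) • legLp T i := by
      rw [legLp, ← MemLp.toLp_const_smul, MemLp.toLp_eq_toLp_iff]
      refine Filter.Eventually.of_forall fun t => ?_
      simp only [Pi.smul_apply, smul_eq_mul, legP_eq]
      have hs : ((-1 : ℝ) ^ i) * (-1) ^ i = 1 := by rw [← mul_pow]; simp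
      change (realShiftedLegendre i).eval (t / T) = _
      field_simp
      linear_combination -(realShiftedLegendre i).eval (t / T) * hs
    rw [hS]
    exact Submodule.smul_mem _ _ (Submodule.subset_span ⟨i, rfl⟩)
  | zero =>
    convert! Submodule.zero_mem _
    rw [← MemLp.toLp_zero (MemLp.zero' (p := 2) (μ := volume.restrict (Set.Ioc 0 T))),
      MemLp.toLp_eq_toLp_iff]
    exact Filter.Eventually.of_forall fun t => by simp
  | add q r _ _ hq hr =>
    convert! Submodule.add_mem _ hq hr
    rw [← MemLp.toLp_add, MemLp.toLp_eq_toLp_iff]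
    exact Filter.Eventually.of_forall fun t => by simp
  | smul a q _ hq =>
    convert! Submodule.smul_mem _ a hq
    rw [← MemLp.toLp_const_smul, MemLp.toLp_eq_toLp_iff]
    exact Filter.Eventually.of_forall fun t => by simp

open Polynomial in
theorem dense_span_legLp {T : ℝ} (hT : 0 < T) :
    ⊤ ≤ (Submodule.span ℝ (Set.range (legLp T))).topologicalClosure := by
  intro f _
  change f ∈ closure _
  rw [Metric.mem_closure_iff]
  intro ε hε
  have hε4 : ENNReal.ofReal (ε / 4) ≠ 0 := by simp; positivity
  obtain ⟨g, hg, hgm⟩ := (Lp.memLp f).exists_boundedContinuous_eLpNorm_sub_le (by simp) hε4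
  obtain ⟨δ, hδ, hδ2⟩ := ENNReal.exists_nnreal_pos_mul_lt
    (a := (volume.restrict (Set.Ioc 0 T)) Set.univ ^ ((2 : ENNReal).toReal)⁻¹) (by simp) hε4
  obtain ⟨q, hq⟩ := exists_polynomial_near_of_continuousOn 0 T g g.continuous.continuousOn δ
    (by exact_mod_cast hδ)
  refine ⟨_, toLp_polynomial_mem_span hT (q.comp (C T * X)), ?_⟩
  have hpt : ∀ t, (q.comp (C T * X)).eval (t / T) = q.eval t := fun t => by
    simp [mul_div_cancel₀ t hT.ne']
  simp_rw [hpt]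
  have hqm := q.continuous.memLp_restrict_Ioc T
  have hgq : eLpNorm (⇑g - fun t => q.eval t) 2 (volume.restrict (Set.Ioc 0 T)) ≤
      ENNReal.ofReal (ε / 4) := by
    refine (eLpNorm_le_of_ae_bound (C := δ) (ae_restrict_of_forall_mem measurableSet_Ioc
      fun x hx => ?_)).trans ?_
    · rw [Pi.sub_apply, norm_sub_rev]
      exact (hq x (Set.Ioc_subset_Icc_self hx)).le
    · rw [mul_comm, ENNReal.ofReal_coe_nnreal]
      exact hδ2.le
  have htri : edist f hqm.toLp ≤ ENNReal.ofReal (ε / 4) + ENNReal.ofReal (ε / 4) := by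
    refine (edist_triangle f hgm.toLp hqm.toLp).trans (add_le_add ?_ ?_)
    · rw [Lp.edist_def]
      refine (eLpNorm_congr_ae ?_).trans_le hg
      filter_upwards [hgm.coeFn_toLp] with t h1
      simp [h1]
    · rwa [Lp.edist_toLp_toLp]
  rw [← @edist_lt_ofReal (Lp ℝ 2 (volume.restrict (Set.Ioc 0 T)))]
  refine htri.trans_lt ?_
  rw [← ENNReal.ofReal_add (by positivity) (by positivity), ENNReal.ofReal_lt_ofReal_iff hε]
  linarith

/-- Parseval's identity on `L²(0, T]` for the normalized shifted Legendre polynomials. -/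
theorem hasSum_sq_integral_legP_mul {T : ℝ} (hT : 0 < T) {f : ℝ → ℝ}
    (hf : MemLp f 2 (volume.restrict (Set.Ioc 0 T))) :
    HasSum (fun i => (∫ t in (0:ℝ)..T, legP T i t * f t) ^ 2)
      (∫ t in Set.Ioc 0 T, f t ^ 2) := by
  have h := (HilbertBasis.mk (orthonormal_legLp hT) (dense_span_legLp hT)).hasSum_inner_mul_inner
    hf.toLp hf.toLp
  convert! h using 1
  · ext i
    rw [HilbertBasis.coe_mk, real_inner_comm, inner_legLp hT i hf, sq]
  · rw [L2.inner_def]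
    refine integral_congr_ae ?_
    filter_upwards [hf.coeFn_toLp] with t h1
    rw [h1]
    simp [sq]

theorem tsum_ofReal_sq_integral_legP_mul {T : ℝ} (hT : 0 < T) {f : ℝ → ℝ}
    (hf : MemLp f 2 (volume.restrict (Set.Ioc 0 T))) :
    ∑' i, ENNReal.ofReal ((∫ t in (0:ℝ)..T, legP T i t * f t) ^ 2) =
      ∫⁻ t in Set.Ioc 0 T, ENNReal.ofReal (f t ^ 2) := by
  have h := hasSum_sq_integral_legP_mul hT hf
  rw [← ENNReal.ofReal_tsum_of_nonneg (fun _ => sq_nonneg _) h.summable, h.tsum_eq,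
    ofReal_integral_eq_lintegral_ofReal hf.integrable_sq
      (Filter.Eventually.of_forall fun _ => sq_nonneg _)]

/-- The beta integral transported to an arbitrary interval. -/
theorem lintegral_sub_rpow_mul_sub_rpow {b c u t : ℝ} (hb : 0 < b) (hc : 0 < c) (hut : u < t) :
    ∫⁻ v in Set.Ioo u t, ENNReal.ofReal ((t - v) ^ (b - 1) * (v - u) ^ (c - 1)) =
      ENNReal.ofReal ((t - u) ^ (b + c - 1) * ProbabilityTheory.beta c b) := by
  have htu : 0 < t - u := sub_pos.2 hut
  have himg : (fun x => u + (t - u) * x) '' Set.Ioo 0 1 = Set.Ioo u t := by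
    ext v
    constructor
    · rintro ⟨x, ⟨h0, h1⟩, rfl⟩
      exact ⟨by simp; positivity, by dsimp only; nlinarith⟩
    · rintro ⟨h0, h1⟩
      refine ⟨(v - u) / (t - u), ⟨div_pos (sub_pos.2 h0) htu, ?_⟩, ?_⟩
      · rw [div_lt_one htu]; linarith
      · field_simp; ring
  rw [← himg, lintegral_image_eq_lintegral_abs_deriv_mul measurableSet_Ioo
    (f' := fun _ => t - u)
    (fun x _ => by
      simpa using (((hasDerivAt_id x).const_mul (t - u)).const_add u).hasDerivWithinAt)
    (fun x _ y _ h => by simpa [htu.ne'] using h)]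
  rw [ENNReal.ofReal_mul (by positivity), ← lintegral_rpow_mul_one_sub_rpow hc hb,
    ← lintegral_const_mul _ (by fun_prop)]
  refine setLIntegral_congr_fun measurableSet_Ioo fun x hx => ?_
  have hx1 : 0 < 1 - x := sub_pos.2 hx.2
  rw [← ENNReal.ofReal_mul (abs_nonneg _), ← ENNReal.ofReal_mul (by positivity),
    abs_of_pos htu]
  congr 1
  rw [show t - (u + (t - u) * x) = (t - u) * (1 - x) by ring,
    show u + (t - u) * x - u = (t - u) * x by ring, Real.mul_rpow htu.le hx1.le,
    Real.mul_rpow htu.le hx.1.le, show b + c - 1 = 1 + (b - 1) + (c - 1) by ring,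
    Real.rpow_add htu, Real.rpow_add htu, Real.rpow_one]
  ring

theorem hasDerivAt_ratio {u v s : ℝ} (hu : u ≠ 0) (hs : v - s ≠ 0) :
    HasDerivAt (fun s => v * (u - s) / (u * (v - s))) (-(v * (v - u) / (u * (v - s) ^ 2))) s := by
  have h1 : HasDerivAt (fun s => v * (u - s)) (v * -1) s :=
    ((hasDerivAt_id s).const_sub u).const_mul v
  have h2 : HasDerivAt (fun s => u * (v - s)) (u * -1) s :=
    ((hasDerivAt_id s).const_sub v).const_mul u
  convert! h1.div h2 (mul_ne_zero hu hs) using 1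
  field_simp
  ring

theorem image_ratio {u v : ℝ} (hu : 0 < u) (huv : u < v) :
    (fun s => v * (u - s) / (u * (v - s))) '' Set.Ioo 0 u = Set.Ioo 0 1 := by
  have hv : 0 < v := hu.trans huv
  ext x
  constructor
  · rintro ⟨s, ⟨h0, h1⟩, rfl⟩
    have hus : 0 < u - s := sub_pos.2 h1
    have hvs : 0 < v - s := by linarith
    refine ⟨by dsimp only; positivity, ?_⟩
    dsimp only
    rw [div_lt_one (by positivity)]
    nlinarith
  · rintro ⟨h0, h1⟩
    have hx : 0 < 1 - x := sub_pos.2 h1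
    have hd : 0 < v - u * x := by nlinarith
    refine ⟨u * v * (1 - x) / (v - u * x), ⟨by positivity, ?_⟩, ?_⟩
    · rw [div_lt_iff₀ hd]
      nlinarith [mul_pos hu (mul_pos h0 (sub_pos.2 huv))]
    · have hd' := hd.ne'
      have e1 : u - u * v * (1 - x) / (v - u * x) = u * x * (v - u) / (v - u * x) := by
        field_simp; ring
      have e2 : v - u * v * (1 - x) / (v - u * x) = v * (v - u) / (v - u * x) := by
        field_simp; ring
      have hvu : v - u ≠ 0 := (sub_pos.2 huv).ne'
      simp only [e1, e2]
      field_simp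

/-- The integral representation of the Riesz kernel `|u - v| ^ (2α - 1)` as a product of two
Riemann–Liouville kernels. -/
theorem lintegral_rpow_mul_sub_rpow_mul_sub_rpow {α u v : ℝ} (hα : 0 < α) (hα2 : α < 1 / 2)
    (hu : 0 < u) (huv : u < v) :
    ∫⁻ s in Set.Ioo 0 u, ENNReal.ofReal (s ^ (-2 * α) * (u - s) ^ (α - 1) * (v - s) ^ (α - 1)) =
      ENNReal.ofReal (ProbabilityTheory.beta α (1 - 2 * α) * (v - u) ^ (2 * α - 1) *
        (u ^ (-α) * v ^ (-α))) := by
  have hv : 0 < v := hu.trans huv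
  have hvu : 0 < v - u := sub_pos.2 huv
  have hinj : Set.InjOn (fun s => v * (u - s) / (u * (v - s))) (Set.Ioo 0 u) := by
    intro s hs s' hs' h
    have h1 : v - s ≠ 0 := by have := hs.2; linarith
    have h2 : v - s' ≠ 0 := by have := hs'.2; linarith
    simp only at h
    field_simp at h
    have : (v - u) * (s - s') = 0 := by linear_combination -h
    have := (mul_eq_zero.1 this).resolve_left hvu.ne'
    linarith
  have key := lintegral_rpow_mul_one_sub_rpow hα (show 0 < 1 - 2 * α by linarith)
  rw [← image_ratio hu huv, lintegral_image_eq_lintegral_abs_deriv_mul measurableSet_Ioo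
    (fun s hs => (hasDerivAt_ratio hu.ne' (by have := hs.2; linarith)).hasDerivWithinAt) hinj]
    at key
  have hpt : ∀ s ∈ Set.Ioo 0 u,
      ENNReal.ofReal |-(v * (v - u) / (u * (v - s) ^ 2))| *
        ENNReal.ofReal ((v * (u - s) / (u * (v - s))) ^ (α - 1) *
          (1 - v * (u - s) / (u * (v - s))) ^ (1 - 2 * α - 1)) =
      ENNReal.ofReal ((v - u) ^ (1 - 2 * α) * (u ^ α * v ^ α)) *
        ENNReal.ofReal (s ^ (-2 * α) * (u - s) ^ (α - 1) * (v - s) ^ (α - 1)) := by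
    intro s hs
    have h0 : 0 < s := hs.1
    have hus : 0 < u - s := sub_pos.2 hs.2
    have hvs : 0 < v - s := by linarith
    have e : 1 - v * (u - s) / (u * (v - s)) = s * (v - u) / (u * (v - s)) := by
      field_simp; ring
    rw [← ENNReal.ofReal_mul (abs_nonneg _), ← ENNReal.ofReal_mul (by positivity), e, abs_neg,
      abs_of_pos (by positivity)]
    congr 1
    rw [Real.div_rpow (by positivity) (by positivity),
      Real.div_rpow (by positivity) (by positivity),
      Real.mul_rpow hv.le hus.le, Real.mul_rpow hu.le hvs.le, Real.mul_rpow h0.le hvu.le,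
      Real.mul_rpow hu.le hvs.le, show 1 - 2 * α - 1 = -2 * α by ring,
      show -2 * α = -(α + α) by ring, show 1 - 2 * α = 1 + -(α + α) by ring,
      Real.rpow_add hvu, Real.rpow_one]
    simp only [Real.rpow_sub hu, Real.rpow_sub hv, Real.rpow_sub hvs, Real.rpow_one,
      Real.rpow_neg hu.le, Real.rpow_neg hvs.le, Real.rpow_add hu, Real.rpow_add hvs]
    have := Real.rpow_pos_of_pos hu α
    have := Real.rpow_pos_of_pos hv α
    have := Real.rpow_pos_of_pos hvs α
    field_simp
  rw [setLIntegral_congr_fun measurableSet_Ioo hpt, lintegral_const_mul _ (by fun_prop)] at key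
  have hc : 0 < (v - u) ^ (1 - 2 * α) * (u ^ α * v ^ α) := by positivity
  rw [← one_mul (∫⁻ s in _, _), ← ENNReal.inv_mul_cancel (a := ENNReal.ofReal
      ((v - u) ^ (1 - 2 * α) * (u ^ α * v ^ α))) (by simpa) ENNReal.ofReal_ne_top,
    mul_assoc, key, ← ENNReal.ofReal_inv_of_pos hc, ← ENNReal.ofReal_mul (by positivity)]
  congr 1
  rw [show 2 * α - 1 = -(1 - 2 * α) by ring, Real.rpow_neg hvu.le, Real.rpow_neg hu.le,
    Real.rpow_neg hv.le, mul_inv, mul_inv]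
  ring

theorem lintegral_sub_rpow {t a : ℝ} (ht : 0 < t) (ha : 0 < a) :
    ∫⁻ u in Set.Ioo 0 t, ENNReal.ofReal ((t - u) ^ (a - 1)) = ENNReal.ofReal (t ^ a / a) := by
  have h := lintegral_sub_rpow_mul_sub_rpow ha one_pos ht
  simp only [sub_self, Real.rpow_zero, mul_one, sub_zero] at h
  rw [h]
  congr 1
  rw [ProbabilityTheory.beta, Real.Gamma_one, add_comm 1 a, Real.Gamma_add_one ha.ne']
  have := (Real.Gamma_pos_of_pos ha).ne'
  field_simp
  ring_nf

theorem lintegral_lintegral_sub_rpow {α β t : ℝ} (hα : 0 < α) (hβ : 0 < β)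
    (hαβ : 0 < 2 * β + 2 * α - 1) (ht : 0 < t) :
    ∫⁻ u in Set.Ioo 0 t, ∫⁻ v in Set.Ioo u t,
      ENNReal.ofReal ((t - u) ^ (β - 1) * ((t - v) ^ (β - 1) * (v - u) ^ (2 * α - 1))) =
      ENNReal.ofReal (ProbabilityTheory.beta (2 * α) β *
        (t ^ (2 * β + 2 * α - 1) / (2 * β + 2 * α - 1))) := by
  have hB := ProbabilityTheory.beta_pos (show 0 < 2 * α by linarith) hβ
  rw [ENNReal.ofReal_mul hB.le, ← lintegral_sub_rpow ht hαβ, ← lintegral_const_mul _ (by fun_prop)]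
  refine setLIntegral_congr_fun measurableSet_Ioo fun u hu => ?_
  have htu : 0 < t - u := sub_pos.2 hu.2
  simp_rw [ENNReal.ofReal_mul (Real.rpow_nonneg htu.le (β - 1))]
  rw [lintegral_const_mul _ (by fun_prop),
    lintegral_sub_rpow_mul_sub_rpow hβ (show 0 < 2 * α by linarith) hu.2,
    ← ENNReal.ofReal_mul (by positivity), ← ENNReal.ofReal_mul hB.le]
  congr 1
  rw [show 2 * β + 2 * α - 1 - 1 = (β - 1) + (β + 2 * α - 1) by ring, Real.rpow_add htu]
  ring

theorem lintegral_lintegral_of_symm {F : ℝ → ℝ → ENNReal} (hF : Measurable (Function.uncurry F))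
    (hsymm : ∀ u v, F u v = F v u) :
    ∫⁻ u, ∫⁻ v, F u v = 2 * ∫⁻ u, ∫⁻ v in Set.Ioi u, F u v := by
  have hlt : MeasurableSet {p : ℝ × ℝ | p.1 < p.2} := measurableSet_lt measurable_fst measurable_snd
  have hind : Measurable (Function.uncurry fun u v : ℝ => (Set.Ioi u).indicator (F u) v) := by
    convert! hF.indicator hlt using 1
  have hsplit : ∀ u, ∫⁻ v, F u v =
      (∫⁻ v, (Set.Ioi u).indicator (F u) v) + ∫⁻ v, (Set.Ioi v).indicator (F v) u := by
    intro u
    have h1 : Measurable fun v => (Set.Ioi u).indicator (F u) v :=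
      hind.comp (measurable_const.prodMk measurable_id)
    rw [← lintegral_add_left h1]
    refine lintegral_congr_ae ?_
    filter_upwards [Measure.ae_ne volume u] with v hv
    rcases lt_or_gt_of_ne hv with h | h
    · simp [Set.indicator, h, h.not_gt, hsymm u v]
    · simp [Set.indicator, h, h.not_gt]
  simp_rw [hsplit]
  have h2 : Measurable fun u => ∫⁻ v, (Set.Ioi u).indicator (F u) v := hind.lintegral_prod_right
  rw [lintegral_add_left h2, two_mul]
  congr 1
  · simp_rw [lintegral_indicator measurableSet_Ioi]
  · rw [lintegral_lintegral_swap (f := fun u v => (Set.Ioi v).indicator (F v) u)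
      (hind.comp measurable_swap).aemeasurable]
    simp_rw [lintegral_indicator measurableSet_Ioi]

/-- The integrand, in the intermediate variable `u`, of the kernel of the composition
`J^β ∘ u^α ∘ J^α ∘ s^(-α)` of Riemann–Liouville operators, without the gamma factors. -/
noncomputable def rlKernel (α β t u s : ℝ) : ℝ :=
  if 0 < s ∧ s < u ∧ u < t then (t - u) ^ (β - 1) * (u ^ α * ((u - s) ^ (α - 1) * s ^ (-α))) else 0

theorem rlKernel_nonneg (α β t u s : ℝ) : 0 ≤ rlKernel α β t u s := by
  unfold rlKernel
  split_ifs with h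
  · have := h.1
    have h1 : 0 < u - s := sub_pos.2 h.2.1
    have h2 : 0 < t - u := sub_pos.2 h.2.2
    have h3 : 0 < u := by linarith
    positivity
  · exact le_rfl

theorem measurable_rlKernel (α β : ℝ) :
    Measurable fun p : ℝ × ℝ × ℝ => rlKernel α β p.1 p.2.1 p.2.2 := by
  unfold rlKernel
  refine Measurable.ite ?_ (by fun_prop) measurable_const
  exact (measurableSet_lt measurable_const measurable_snd.snd).inter
    ((measurableSet_lt measurable_snd.snd measurable_snd.fst).inter
      (measurableSet_lt measurable_snd.fst measurable_fst))

theorem measurable_rlKernel_uncurry (α β t : ℝ) :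
    Measurable fun p : ℝ × ℝ => rlKernel α β t p.1 p.2 :=
  (measurable_rlKernel α β).comp (measurable_const.prodMk measurable_id)

theorem lintegral_rlKernel_mul_rlKernel {α β t u v : ℝ} (hα : 0 < α) (hα2 : α < 1 / 2)
    (huv : u < v) :
    ∫⁻ s, ENNReal.ofReal (rlKernel α β t u s) * ENNReal.ofReal (rlKernel α β t v s) =
      if 0 < u ∧ v < t then
        ENNReal.ofReal (ProbabilityTheory.beta α (1 - 2 * α)) *
          ENNReal.ofReal ((t - u) ^ (β - 1) * ((t - v) ^ (β - 1) * (v - u) ^ (2 * α - 1)))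
      else 0 := by
  split_ifs with h
  · obtain ⟨hu, hvt⟩ := h
    have hv : 0 < v := hu.trans huv
    have hut : 0 < t - u := by linarith
    have hvt' : 0 < t - v := by linarith
    have hB := ProbabilityTheory.beta_pos hα (show 0 < 1 - 2 * α by linarith)
    have hpt : ∀ s, ENNReal.ofReal (rlKernel α β t u s) * ENNReal.ofReal (rlKernel α β t v s) =
        (Set.Ioo 0 u).indicator (fun s =>
          ENNReal.ofReal ((t - u) ^ (β - 1) * (t - v) ^ (β - 1) * (u ^ α * v ^ α)) *
          ENNReal.ofReal (s ^ (-2 * α) * (u - s) ^ (α - 1) * (v - s) ^ (α - 1))) s := by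
      intro s
      rw [← ENNReal.ofReal_mul (rlKernel_nonneg _ _ _ _ _)]
      by_cases hs : s ∈ Set.Ioo 0 u
      · have hs0 : 0 < s := hs.1
        rw [Set.indicator_of_mem hs, ← ENNReal.ofReal_mul (by positivity), rlKernel, rlKernel,
          if_pos ⟨hs.1, hs.2, by linarith⟩, if_pos ⟨hs.1, hs.2.trans huv, hvt⟩]
        congr 1
        rw [show -2 * α = -α + -α by ring, Real.rpow_add hs0]
        ring
      · rw [Set.indicator_of_notMem hs, rlKernel, if_neg fun h' => hs ⟨h'.1, h'.2.1⟩]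
        simp
    simp_rw [hpt]
    rw [lintegral_indicator measurableSet_Ioo, lintegral_const_mul _ (by fun_prop),
      lintegral_rpow_mul_sub_rpow_mul_sub_rpow hα hα2 hu huv,
      ← ENNReal.ofReal_mul (by positivity), ← ENNReal.ofReal_mul hB.le]
    congr 1
    have := Real.rpow_pos_of_pos hu α
    have := Real.rpow_pos_of_pos hv α
    rw [Real.rpow_neg hu.le, Real.rpow_neg hv.le]
    field_simp
  · rw [lintegral_eq_zero_iff']
    · refine Filter.Eventually.of_forall fun s => ?_
      by_cases hu : 0 < s ∧ s < u ∧ u < t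
      · have : ¬ (0 < s ∧ s < v ∧ v < t) := fun h' => h ⟨by linarith [hu.1, hu.2.1], h'.2.2⟩
        simp [rlKernel, if_neg this]
      · simp [rlKernel, if_neg hu]
    · have h1 := (measurable_rlKernel_uncurry α β t).comp (measurable_const (a := u) |>.prodMk
        measurable_id)
      have h2 := (measurable_rlKernel_uncurry α β t).comp (measurable_const (a := v) |>.prodMk
        measurable_id)
      exact (h1.ennreal_ofReal.mul h2.ennreal_ofReal).aemeasurable

theorem lintegral_sq_lintegral_rlKernel {α β t : ℝ} (hα : 0 < α) (hα2 : α < 1 / 2) (hβ : 0 < β)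
    (hαβ : 0 < 2 * β + 2 * α - 1) (ht : 0 < t) :
    ∫⁻ s, (∫⁻ u, ENNReal.ofReal (rlKernel α β t u s)) ^ 2 =
      ENNReal.ofReal (2 * (ProbabilityTheory.beta α (1 - 2 * α) *
        (ProbabilityTheory.beta (2 * α) β *
          (t ^ (2 * β + 2 * α - 1) / (2 * β + 2 * α - 1))))) := by
  have hB := ProbabilityTheory.beta_pos hα (show 0 < 1 - 2 * α by linarith)
  have hm : Measurable fun p : ℝ × ℝ => ENNReal.ofReal (rlKernel α β t p.1 p.2) :=
    (measurable_rlKernel_uncurry α β t).ennreal_ofReal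
  have hm1 : ∀ s, Measurable fun u => ENNReal.ofReal (rlKernel α β t u s) := fun s =>
    hm.comp (measurable_id.prodMk measurable_const)
  have hm3 : Measurable fun p : (ℝ × ℝ) × ℝ => ENNReal.ofReal (rlKernel α β t p.1.1 p.2) *
      ENNReal.ofReal (rlKernel α β t p.1.2 p.2) :=
    (hm.comp ((measurable_fst.comp measurable_fst).prodMk measurable_snd)).mul
      (hm.comp ((measurable_snd.comp measurable_fst).prodMk measurable_snd))
  have hsq : ∀ s, (∫⁻ u, ENNReal.ofReal (rlKernel α β t u s)) ^ 2 =
      ∫⁻ p : ℝ × ℝ, ENNReal.ofReal (rlKernel α β t p.1 s) *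
        ENNReal.ofReal (rlKernel α β t p.2 s) := by
    intro s
    rw [sq, ← lintegral_prod_mul (hm1 s).aemeasurable (hm1 s).aemeasurable]
    rfl
  simp_rw [hsq]
  rw [lintegral_lintegral_swap (f := fun s (p : ℝ × ℝ) => ENNReal.ofReal (rlKernel α β t p.1 s) *
    ENNReal.ofReal (rlKernel α β t p.2 s)) (hm3.comp measurable_swap).aemeasurable]
  have hF : Measurable fun p : ℝ × ℝ => ∫⁻ s, ENNReal.ofReal (rlKernel α β t p.1 s) *
      ENNReal.ofReal (rlKernel α β t p.2 s) := hm3.lintegral_prod_right'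
  rw [Measure.volume_eq_prod, lintegral_prod _ hF.aemeasurable,
    lintegral_lintegral_of_symm (F := fun u v => ∫⁻ s, ENNReal.ofReal (rlKernel α β t u s) *
      ENNReal.ofReal (rlKernel α β t v s)) hF (fun u v => by simp_rw [mul_comm])]
  rw [ENNReal.ofReal_mul zero_le_two, ENNReal.ofReal_ofNat, ENNReal.ofReal_mul hB.le,
    ← lintegral_lintegral_sub_rpow hα hβ hαβ ht]
  congr 1
  rw [← lintegral_const_mul' _ _ ENNReal.ofReal_ne_top, ← lintegral_indicator measurableSet_Ioo]
  refine lintegral_congr fun u => ?_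
  rw [setLIntegral_congr_fun measurableSet_Ioi
    (fun v hv => lintegral_rlKernel_mul_rlKernel (β := β) (t := t) hα hα2 hv)]
  by_cases hu : u ∈ Set.Ioo 0 t
  · rw [Set.indicator_of_mem hu, ← lintegral_const_mul' _ _ ENNReal.ofReal_ne_top,
      ← lintegral_indicator measurableSet_Ioi, ← lintegral_indicator measurableSet_Ioo]
    refine lintegral_congr fun v => ?_
    simp only [Set.indicator, Set.mem_Ioi, Set.mem_Ioo, hu.1, true_and]
    split_ifs <;> first | rfl | tauto
  · rw [Set.indicator_of_notMem hu]
    exact setLIntegral_eq_zero measurableSet_Ioi fun v hv =>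
      if_neg fun h => hu ⟨h.1, lt_trans hv h.2⟩

/-- The kernel of `J^β ∘ u^α ∘ J^α ∘ s^(-α)`, without the gamma factors. -/
noncomputable def rlCompKernel (α β t s : ℝ) : ℝ := ∫ u, rlKernel α β t u s

theorem rlCompKernel_eq_toReal (α β t s : ℝ) :
    rlCompKernel α β t s = (∫⁻ u, ENNReal.ofReal (rlKernel α β t u s)).toReal :=
  integral_eq_lintegral_of_nonneg_ae
    (Filter.Eventually.of_forall fun u => rlKernel_nonneg α β t u s)
    ((measurable_rlKernel_uncurry α β t).comp
      (measurable_id.prodMk measurable_const)).aestronglyMeasurable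

theorem measurable_rlCompKernel (α β : ℝ) :
    Measurable (Function.uncurry (rlCompKernel α β)) := by
  have h : Measurable fun p : (ℝ × ℝ) × ℝ => ENNReal.ofReal (rlKernel α β p.1.1 p.2 p.1.2) :=
    ((measurable_rlKernel α β).comp ((measurable_fst.comp measurable_fst).prodMk
      (measurable_snd.prodMk (measurable_snd.comp measurable_fst)))).ennreal_ofReal
  have h2 := (h.lintegral_prod_right' (ν := volume)).ennreal_toReal
  simp_rw [← rlCompKernel_eq_toReal] at h2
  exact h2

theorem rlKernel_eq_zero {α β t u s : ℝ} (hs : s ∉ Set.Ioo 0 t) : rlKernel α β t u s = 0 :=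
  if_neg fun h => hs ⟨h.1, h.2.1.trans h.2.2⟩

theorem rlCompKernel_eq_zero {α β t s : ℝ} (hs : s ∉ Set.Ioo 0 t) : rlCompKernel α β t s = 0 := by
  simp [rlCompKernel, rlKernel_eq_zero hs]

theorem lintegral_sq_rlCompKernel {α β t : ℝ} (hα : 0 < α) (hα2 : α < 1 / 2) (hβ : 0 < β)
    (hαβ : 0 < 2 * β + 2 * α - 1) (ht : 0 < t) :
    ∫⁻ s, ENNReal.ofReal (rlCompKernel α β t s ^ 2) =
      ENNReal.ofReal (2 * (ProbabilityTheory.beta α (1 - 2 * α) *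
        (ProbabilityTheory.beta (2 * α) β *
          (t ^ (2 * β + 2 * α - 1) / (2 * β + 2 * α - 1))))) := by
  have h := lintegral_sq_lintegral_rlKernel hα hα2 hβ hαβ ht
  rw [← h]
  have hm : Measurable fun s => (∫⁻ u, ENNReal.ofReal (rlKernel α β t u s)) ^ 2 :=
    (measurable_rlKernel_uncurry α β t).ennreal_ofReal.lintegral_prod_left'.pow_const 2
  refine lintegral_congr_ae ?_
  filter_upwards [ae_lt_top hm (by rw [h]; exact ENNReal.ofReal_ne_top)] with s hs
  rw [rlCompKernel_eq_toReal, ENNReal.ofReal_pow ENNReal.toReal_nonneg, ENNReal.ofReal_toReal]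
  intro h'
  simp [h'] at hs

theorem integrable_rlKernel {α β t : ℝ} (hα : 0 < α) (hα2 : α < 1 / 2) (hβ : 0 < β)
    (hαβ : 0 < 2 * β + 2 * α - 1) (ht : 0 < t) :
    Integrable (fun p : ℝ × ℝ => rlKernel α β t p.1 p.2) (volume.prod volume) := by
  have hm := measurable_rlKernel_uncurry α β t
  refine ⟨hm.aestronglyMeasurable, ?_⟩
  rw [hasFiniteIntegral_iff_ofReal (f := fun p : ℝ × ℝ => rlKernel α β t p.1 p.2)
      (Filter.Eventually.of_forall fun p => rlKernel_nonneg α β t p.1 p.2),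
    lintegral_prod_symm _ hm.ennreal_ofReal.aemeasurable]
  have hle : ∀ s, ∫⁻ u, ENNReal.ofReal (rlKernel α β t u s) ≤
      (Set.Ioo 0 t).indicator 1 s + (∫⁻ u, ENNReal.ofReal (rlKernel α β t u s)) ^ 2 := by
    intro s
    by_cases hs : s ∈ Set.Ioo 0 t
    · rw [Set.indicator_of_mem hs]
      generalize ∫⁻ u, ENNReal.ofReal (rlKernel α β t u s) = x
      rcases le_total x 1 with hx | hx
      · exact hx.trans le_self_add
      · exact (le_self_pow₀ hx two_ne_zero).trans le_add_self
    · simp [rlKernel_eq_zero hs]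
  refine (lintegral_mono hle).trans_lt ?_
  rw [lintegral_add_left (measurable_one.indicator measurableSet_Ioo),
    lintegral_sq_lintegral_rlKernel hα hα2 hβ hαβ ht, lintegral_indicator_one measurableSet_Ioo]
  exact ENNReal.add_lt_top.2 ⟨by simp, ENNReal.ofReal_lt_top⟩

/-- The composition `J^β ∘ u^α ∘ J^α ∘ s^(-α)` is an integral operator with kernel
`rlCompKernel`. -/
theorem rlInt_comp_eq {α β t T : ℝ} (hα : 0 < α) (hα2 : α < 1 / 2) (hβ : 0 < β)
    (hαβ : 0 < 2 * β + 2 * α - 1) (ht : 0 < t) (htT : t ≤ T) {φ : ℝ → ℝ} (hφ : Continuous φ) :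
    rlInt β (fun u => u ^ α * rlInt α (fun s => s ^ (-α) * φ s) u) t =
      1 / (Real.Gamma α * Real.Gamma β) * ∫ s in (0:ℝ)..T, rlCompKernel α β t s * φ s := by
  obtain ⟨C, hC⟩ := (isCompact_Icc (a := (0:ℝ)) (b := t)).exists_bound_of_continuousOn
    hφ.continuousOn
  have hint : Integrable (fun p : ℝ × ℝ => rlKernel α β t p.1 p.2 * φ p.2)
      (volume.prod volume) := by
    refine ((integrable_rlKernel hα hα2 hβ hαβ ht).mul_const C).mono'
      ((measurable_rlKernel_uncurry α β t).mul
        (hφ.measurable.comp measurable_snd)).aestronglyMeasurable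
      (Filter.Eventually.of_forall fun p => ?_)
    rw [norm_mul, Real.norm_of_nonneg (rlKernel_nonneg _ _ _ _ _)]
    by_cases hs : p.2 ∈ Set.Ioo 0 t
    · exact mul_le_mul_of_nonneg_left (hC _ (Set.Ioo_subset_Icc_self hs))
        (rlKernel_nonneg _ _ _ _ _)
    · simp [rlKernel_eq_zero hs]
  have hR : ∫ s in (0:ℝ)..T, rlCompKernel α β t s * φ s =
      ∫ s, ∫ u, rlKernel α β t u s * φ s := by
    rw [intervalIntegral.integral_of_le (ht.le.trans htT),
      setIntegral_eq_integral_of_forall_compl_eq_zero]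
    · simp_rw [integral_mul_const, rlCompKernel]
    · intro s hs
      rw [rlCompKernel_eq_zero fun h => hs ⟨h.1, h.2.le.trans htT⟩, zero_mul]
  have hL : ∀ u ∈ Set.Ioo 0 t, ∫ s, rlKernel α β t u s * φ s =
      u ^ α * (∫ s in (0:ℝ)..u, s ^ (-α) * φ s * (u - s) ^ (α - 1)) * (t - u) ^ (β - 1) := by
    intro u hu
    rw [intervalIntegral.integral_of_le hu.1.le, integral_Ioc_eq_integral_Ioo,
      ← integral_const_mul, ← integral_mul_const, ← integral_indicator measurableSet_Ioo]
    congr 1 with s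
    by_cases hs : s ∈ Set.Ioo 0 u
    · rw [Set.indicator_of_mem hs, rlKernel, if_pos ⟨hs.1, hs.2, hu.2⟩]
      ring
    · rw [Set.indicator_of_notMem hs, rlKernel, if_neg fun h => hs ⟨h.1, h.2.1⟩, zero_mul]
  have hL0 : ∀ u ∉ Set.Ioo 0 t, ∫ s, rlKernel α β t u s * φ s = 0 := by
    intro u hu
    have h0 : ∀ s, rlKernel α β t u s = 0 := fun s =>
      if_neg fun h => hu ⟨h.1.trans h.2.1, h.2.2⟩
    simp [h0]
  rw [hR, ← integral_integral_swap hint, ← setIntegral_eq_integral_of_forall_compl_eq_zero hL0,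
    setIntegral_congr_fun measurableSet_Ioo hL, rlInt, intervalIntegral.integral_of_le ht.le,
    integral_Ioc_eq_integral_Ioo, ← integral_const_mul, ← integral_const_mul]
  congr 1 with u
  rw [rlInt, one_div, one_div, one_div, mul_inv]
  ring

/-- If `Kop H` is given on Legendre polynomials by an `L²` kernel whose slices have squared norm
`t ^ (2H)`, then Parseval's identity holds for its Legendre coefficients. -/
theorem hasSum_sq_Kcoef_of_kernel {T H : ℝ} (hT : 0 < T) (hH : 0 < H) {k : ℝ → ℝ → ℝ}
    (hk : Measurable (Function.uncurry k))
    (hK : ∀ j, ∀ t ∈ Set.Ioo 0 T, Kop H (legP T j) t = ∫ s in (0:ℝ)..T, legP T j s * k t s)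
    (hnorm : ∀ t ∈ Set.Ioo 0 T,
      ∫⁻ s in Set.Ioc 0 T, ENNReal.ofReal (k t s ^ 2) = ENNReal.ofReal (t ^ (2 * H))) :
    HasSum (fun p : ℕ × ℕ => (Kcoef T H p.1 p.2) ^ 2) (T ^ (2 * H + 1) / (2 * H + 1)) := by
  set f : ℕ → ℝ → ℝ := fun j t => ∫ s in (0:ℝ)..T, legP T j s * k t s with hf
  have memLp_of_lintegral_ne_top : ∀ g : ℝ → ℝ, Measurable g →
      ∫⁻ s in Set.Ioc 0 T, ENNReal.ofReal (g s ^ 2) ≠ ⊤ →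
      MemLp g 2 (volume.restrict (Set.Ioc 0 T)) := by
    intro g hg hfin
    rw [memLp_two_iff_integrable_sq hg.aestronglyMeasurable]
    refine ⟨(hg.pow_const 2).aestronglyMeasurable, ?_⟩
    rw [hasFiniteIntegral_iff_ofReal (Filter.Eventually.of_forall fun s => sq_nonneg _)]
    exact hfin.lt_top
  have hfm : ∀ j, Measurable (f j) := by
    intro j
    simp_rw [hf, intervalIntegral.integral_of_le hT.le]
    have : Measurable fun p : ℝ × ℝ => legP T j p.2 * k p.1 p.2 :=
      ((continuous_legP T j).measurable.comp measurable_snd).mul hk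
    exact this.stronglyMeasurable.integral_prod_right'.measurable
  have hslice : ∀ t ∈ Set.Ioo 0 T,
      ∑' j, ENNReal.ofReal (f j t ^ 2) = ENNReal.ofReal (t ^ (2 * H)) := by
    intro t ht
    rw [← hnorm t ht]
    refine tsum_ofReal_sq_integral_legP_mul hT (memLp_of_lintegral_ne_top _
      (hk.comp (measurable_const.prodMk measurable_id)) ?_)
    exact (hnorm t ht).trans_ne ENNReal.ofReal_ne_top
  have hsum : ∑' j, ∫⁻ t in Set.Ioc 0 T, ENNReal.ofReal (f j t ^ 2) =
      ENNReal.ofReal (T ^ (2 * H + 1) / (2 * H + 1)) := by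
    rw [← lintegral_tsum fun j => ((hfm j).pow_const 2).ennreal_ofReal.aemeasurable,
      ← Measure.restrict_congr_set Ioo_ae_eq_Ioc, setLIntegral_congr_fun measurableSet_Ioo hslice,
      Measure.restrict_congr_set Ioo_ae_eq_Ioc, ← ofReal_integral_eq_lintegral_ofReal,
      ← intervalIntegral.integral_of_le hT.le, integral_rpow (Or.inl (by linarith)),
      Real.zero_rpow (by linarith), sub_zero]
    · exact (intervalIntegrable_iff_integrableOn_Ioc_of_le hT.le).1
        (intervalIntegral.intervalIntegrable_rpow' (by linarith))
    · filter_upwards [ae_restrict_mem measurableSet_Ioc] with t ht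
      exact Real.rpow_nonneg ht.1.le _
  have hKc : ∀ i j, Kcoef T H i j = ∫ t in (0:ℝ)..T, legP T i t * f j t := by
    intro i j
    rw [Kcoef, intervalIntegral.integral_of_le hT.le, intervalIntegral.integral_of_le hT.le,
      integral_Ioc_eq_integral_Ioo, integral_Ioc_eq_integral_Ioo]
    refine setIntegral_congr_fun measurableSet_Ioo fun t ht => ?_
    simp only [hK j t ht, hf]
  have hcol : ∀ j, ∑' i, ENNReal.ofReal (Kcoef T H i j ^ 2) =
      ∫⁻ t in Set.Ioc 0 T, ENNReal.ofReal (f j t ^ 2) := by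
    intro j
    simp_rw [hKc]
    refine tsum_ofReal_sq_integral_legP_mul hT (memLp_of_lintegral_ne_top _ (hfm j) ?_)
    refine ne_top_of_le_ne_top ?_ (ENNReal.le_tsum
      (f := fun j => ∫⁻ t in Set.Ioc 0 T, ENNReal.ofReal (f j t ^ 2)) j)
    rw [hsum]
    exact ENNReal.ofReal_ne_top
  have htot : ∑' p : ℕ × ℕ, ENNReal.ofReal (Kcoef T H p.1 p.2 ^ 2) =
      ENNReal.ofReal (T ^ (2 * H + 1) / (2 * H + 1)) := by
    rw [ENNReal.tsum_prod', ENNReal.tsum_comm, ← hsum]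
    exact tsum_congr hcol
  have hne : ∑' p : ℕ × ℕ, ENNReal.ofReal (Kcoef T H p.1 p.2 ^ 2) ≠ ⊤ :=
    htot.trans_ne ENNReal.ofReal_ne_top
  have h := ENNReal.hasSum_toReal hne
  rw [← ENNReal.tsum_toReal_eq (ENNReal.ne_top_of_tsum_ne_top hne), htot,
    ENNReal.toReal_ofReal (by positivity)] at h
  simpa only [ENNReal.toReal_ofReal (sq_nonneg _)] using h

theorem aH_sq {H : ℝ} (hH : H ∈ Set.Ioo (0:ℝ) 1) : aH H ^ 2 =
    2 * H * Real.Gamma (H + 1/2) * Real.Gamma (3/2 - H) / Real.Gamma (2 - 2 * H) := by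
  have h1 := Real.Gamma_pos_of_pos (show 0 < H + 1/2 by linarith [hH.1])
  have h2 := Real.Gamma_pos_of_pos (show 0 < 3/2 - H by linarith [hH.2])
  have h3 := Real.Gamma_pos_of_pos (show 0 < 2 - 2 * H by linarith [hH.2])
  have := hH.1
  exact Real.sq_sqrt (by positivity)

theorem aH_normalization_of_lt {H : ℝ} (h0 : 0 < H) (hH : H < 1 / 2) :
    (aH H * (1 / (Real.Gamma (1/2 - H) * Real.Gamma (2 * H)))) ^ 2 *
      (2 * (ProbabilityTheory.beta (1/2 - H) (1 - 2 * (1/2 - H)) *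
        (ProbabilityTheory.beta (2 * (1/2 - H)) (2 * H) / (2 * H)))) = 1 := by
  rw [mul_pow, aH_sq ⟨h0, by linarith⟩, ProbabilityTheory.beta, ProbabilityTheory.beta,
    show 1 - 2 * (1/2 - H) = 2 * H by ring, show 1/2 - H + 2 * H = H + 1/2 by ring,
    show 2 * (1/2 - H) + 2 * H = 1 by ring, Real.Gamma_one,
    show 3/2 - H = (1/2 - H) + 1 by ring, Real.Gamma_add_one (by linarith),
    show 2 - 2 * H = 2 * (1/2 - H) + 1 by ring, Real.Gamma_add_one (by linarith)]
  have h1 := Real.Gamma_pos_of_pos (show 0 < H + 1/2 by linarith)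
  have h2 := Real.Gamma_pos_of_pos (show 0 < 1/2 - H by linarith)
  have h3 := Real.Gamma_pos_of_pos (show 0 < 2 * H by linarith)
  have h4 := Real.Gamma_pos_of_pos (show 0 < 2 * (1/2 - H) by linarith)
  have h5 : 0 < 1/2 - H := by linarith
  generalize 1/2 - H = x at *
  field_simp

theorem aH_normalization_of_gt {H : ℝ} (hH : 1 / 2 < H) (h1 : H < 1) :
    (aH H * (1 / (Real.Gamma (H - 1/2) * Real.Gamma 1))) ^ 2 *
      (2 * (ProbabilityTheory.beta (H - 1/2) (1 - 2 * (H - 1/2)) *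
        (ProbabilityTheory.beta (2 * (H - 1/2)) 1 / (2 * H)))) = 1 := by
  rw [mul_pow, aH_sq ⟨by linarith, h1⟩, ProbabilityTheory.beta, ProbabilityTheory.beta,
    show 1 - 2 * (H - 1/2) = 2 - 2 * H by ring, show H - 1/2 + (2 - 2 * H) = 3/2 - H by ring,
    Real.Gamma_add_one (by linarith), Real.Gamma_one,
    show H + 1/2 = (H - 1/2) + 1 by ring, Real.Gamma_add_one (by linarith)]
  have h7 := Real.Gamma_pos_of_pos (show 0 < 3/2 - H by linarith)
  have h2 := Real.Gamma_pos_of_pos (show 0 < H - 1/2 by linarith)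
  have h3 := Real.Gamma_pos_of_pos (show 0 < 2 - 2 * H by linarith)
  have h4 := Real.Gamma_pos_of_pos (show 0 < 2 * (H - 1/2) by linarith)
  have h5 : 0 < H - 1/2 := by linarith
  have h6 : 0 < H := by linarith
  generalize Real.Gamma (3/2 - H) = a at *
  generalize Real.Gamma (2 - 2 * H) = b at *
  generalize H - 1/2 = x at *
  field_simp

theorem hasSum_sq_Kcoef_of_rlInt {T H α β : ℝ} (hT : 0 < T) (hH : 0 < H) (hα : 0 < α)
    (hα2 : α < 1 / 2) (hβ : 0 < β) (hαβ : 2 * β + 2 * α - 1 = 2 * H)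
    (hK : ∀ φ t, Kop H φ t =
      aH H * rlInt β (fun u => u ^ α * rlInt α (fun s => s ^ (-α) * φ s) u) t)
    (hc : (aH H * (1 / (Real.Gamma α * Real.Gamma β))) ^ 2 *
      (2 * (ProbabilityTheory.beta α (1 - 2 * α) *
        (ProbabilityTheory.beta (2 * α) β / (2 * H)))) = 1) :
    HasSum (fun p : ℕ × ℕ => (Kcoef T H p.1 p.2) ^ 2) (T ^ (2 * H + 1) / (2 * H + 1)) := by
  have hαβ' : 0 < 2 * β + 2 * α - 1 := by linarith
  set c := aH H * (1 / (Real.Gamma α * Real.Gamma β)) with hcdef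
  refine hasSum_sq_Kcoef_of_kernel hT hH (k := fun t s => c * rlCompKernel α β t s)
    ((measurable_rlCompKernel α β).const_mul c) ?_ ?_
  · intro j t ht
    rw [hK, rlInt_comp_eq hα hα2 hβ hαβ' ht.1 ht.2.le (continuous_legP T j), ← mul_assoc,
      ← hcdef, ← intervalIntegral.integral_const_mul]
    congr 1 with s
    ring
  · intro t ht
    have hsupp : ∫⁻ s in Set.Ioc 0 T, ENNReal.ofReal ((c * rlCompKernel α β t s) ^ 2) =
        ∫⁻ s, ENNReal.ofReal ((c * rlCompKernel α β t s) ^ 2) := by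
      rw [← lintegral_indicator measurableSet_Ioc]
      refine lintegral_congr fun s => ?_
      by_cases hs : s ∈ Set.Ioc 0 T
      · rw [Set.indicator_of_mem hs]
      · rw [Set.indicator_of_notMem hs,
          rlCompKernel_eq_zero fun h => hs ⟨h.1, h.2.le.trans ht.2.le⟩]
        simp
    simp_rw [hsupp, mul_pow, ENNReal.ofReal_mul (sq_nonneg c)]
    rw [lintegral_const_mul' _ _ ENNReal.ofReal_ne_top,
      lintegral_sq_rlCompKernel hα hα2 hβ hαβ' ht.1, ← ENNReal.ofReal_mul (sq_nonneg c), hαβ]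
    congr 1
    linear_combination t ^ (2 * H) * hc

theorem hasSum_sq_Kcoef_half {T : ℝ} (hT : 0 < T) :
    HasSum (fun p : ℕ × ℕ => (Kcoef T (1/2) p.1 p.2) ^ 2)
      (T ^ (2 * (1/2 : ℝ) + 1) / (2 * (1/2) + 1)) := by
  refine hasSum_sq_Kcoef_of_kernel hT one_half_pos
    (k := fun t s => if s ≤ t then 1 else 0) ?_ ?_ ?_
  · exact Measurable.ite (measurableSet_le measurable_snd measurable_fst) measurable_const
      measurable_const
  · intro j t ht
    rw [Kop, if_neg (lt_irrefl _), if_neg (lt_irrefl _), intervalIntegral.integral_of_le ht.1.le,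
      intervalIntegral.integral_of_le hT.le, ← integral_indicator measurableSet_Ioc,
      ← integral_indicator measurableSet_Ioc]
    congr 1 with s
    have := ht.2
    simp only [Set.indicator, Set.mem_Ioc, mul_ite, mul_one, mul_zero]
    grind
  · intro t ht
    have h : ∀ s, (Set.Ioc 0 T).indicator
        (fun s => ENNReal.ofReal ((if s ≤ t then (1:ℝ) else 0) ^ 2)) s =
        (Set.Ioc 0 t).indicator 1 s := by
      intro s
      have := ht.2
      simp only [Set.indicator, Set.mem_Ioc, Pi.one_apply]
      have h1 : ENNReal.ofReal ((1:ℝ) ^ 2) = 1 := by simp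
      have h0 : ENNReal.ofReal ((0:ℝ) ^ 2) = 0 := by simp
      split_ifs <;> grind
    rw [← lintegral_indicator measurableSet_Ioc]
    simp_rw [h]
    rw [lintegral_indicator_one measurableSet_Ioc]
    simp

/-- Parseval's identity for the fBm kernel: the double series
`Σ_{i,j} (K_{ij}^H)²` converges with sum `‖k_H‖² = T^{2H+1}/(2H+1)`. -/
theorem Kcoef_parseval (T : ℝ) (hT : 0 < T) (H : ℝ) (hH : H ∈ Set.Ioo (0:ℝ) 1) :
    HasSum (fun p : ℕ × ℕ => (Kcoef T H p.1 p.2) ^ 2) (T ^ (2 * H + 1) / (2 * H + 1)) := by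
  obtain ⟨h0, h1⟩ := hH
  rcases lt_trichotomy H (1/2) with h | h | h
  · refine hasSum_sq_Kcoef_of_rlInt (α := 1/2 - H) (β := 2 * H) hT h0 (by linarith) (by linarith)
      (by linarith) (by ring) (fun φ t => ?_) (aH_normalization_of_lt h0 h)
    rw [Kop, if_pos h, neg_sub]
  · subst h
    exact hasSum_sq_Kcoef_half hT
  · refine hasSum_sq_Kcoef_of_rlInt (α := H - 1/2) (β := 1) hT h0 (by linarith) (by linarith)
      one_pos (by ring) (fun φ t => ?_) (aH_normalization_of_gt h h1)
    rw [Kop, if_neg h.not_gt, if_pos h, neg_sub]
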